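/- arXiv:1205.4656 — 7 statements merged into one kernel-verified Lean document; each statement's English description precedes it below -/
import Mathlib

section
/- Suppose μ* : 𝒳 → V represents the conditional expectation, i.e. μ* is measurable, E[‖μ*(X)‖²] < ∞, and for every h ∈ V one has E[⟨h, φ⟩ | σ(X)] = ⟨h, μ*(X)⟩ P-almost surely. Then 𝓔[μ*] = 0, so μ* minimises the risk 𝓔; moreover any measurable μ : 𝒳 → V with E[‖μ(X)‖²] < ∞ and 𝓔[μ] = 0 satisfies μ(X) = μ*(X) P-almost surely (the minimiser of 𝓔 is almost-surely unique). -/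
open MeasureTheory RealInnerProductSpace

/-- The risk `𝓔[μ] = sup_{‖h‖ ≤ 1} E[(E[⟪h, φ⟫ | σ(X)] − ⟪h, μ(X)⟫)²]`. -/
noncomputable def risk
    {Ω 𝒳 V : Type*} [MeasurableSpace Ω] [MeasurableSpace 𝒳]
    [NormedAddCommGroup V] [InnerProductSpace ℝ V]
    (P : Measure Ω) (X : Ω → 𝒳) (φ : Ω → V) (μ : 𝒳 → V) : ℝ :=
  ⨆ h : {h : V // ‖h‖ ≤ 1},
    ∫ ω, ((P[(fun ω' => ⟪(h : V), φ ω'⟫) | MeasurableSpace.comap X inferInstance]) ω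
      - ⟪(h : V), μ (X ω)⟫) ^ 2 ∂P

/-- When `μstar` represents the conditional expectation, the risk is the supremum of the second
moments of the coordinates of `μstar(X) - μ(X)`. -/
theorem risk_eq_iSup_integral_inner_sub_sq
    {Ω 𝒳 V : Type*} [MeasurableSpace Ω] [MeasurableSpace 𝒳]
    [NormedAddCommGroup V] [InnerProductSpace ℝ V]
    {P : Measure Ω} {X : Ω → 𝒳} {φ : Ω → V} {μstar : 𝒳 → V}
    (hrep : ∀ h : V,
      P[(fun ω => ⟪h, φ ω⟫) | MeasurableSpace.comap X inferInstance]
        =ᵐ[P] fun ω => ⟪h, μstar (X ω)⟫) (μ : 𝒳 → V) :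
    risk P X φ μ =
      ⨆ h : {h : V // ‖h‖ ≤ 1}, ∫ ω, ⟪(h : V), μstar (X ω) - μ (X ω)⟫ ^ 2 ∂P := by
  unfold risk
  congr 1 with h
  refine integral_congr_ae ?_
  filter_upwards [hrep h] with ω hω
  rw [hω, inner_sub_right]

/-- A square-integrable random vector whose coordinates in the unit ball have second moments with
supremum zero vanishes almost surely. -/
theorem ae_eq_zero_of_iSup_integral_inner_sq_eq_zero
    {Ω V : Type*} [MeasurableSpace Ω] [NormedAddCommGroup V] [InnerProductSpace ℝ V]
    [SecondCountableTopology V] {P : Measure Ω} {d : Ω → V} (hd : MemLp d 2 P)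
    (h0 : ⨆ h : {h : V // ‖h‖ ≤ 1}, ∫ ω, ⟪(h : V), d ω⟫ ^ 2 ∂P = 0) :
    d =ᵐ[P] 0 := by
  have hint (h : V) : Integrable (fun ω => ⟪h, d ω⟫ ^ 2) P := (hd.const_inner h).integrable_sq
  have hbdd : BddAbove (Set.range fun h : {h : V // ‖h‖ ≤ 1} => ∫ ω, ⟪(h : V), d ω⟫ ^ 2 ∂P) := by
    refine ⟨∫ ω, ‖d ω‖ ^ 2 ∂P, ?_⟩
    rintro _ ⟨h, rfl⟩
    refine integral_mono (hint h) (hd.integrable_norm_pow two_ne_zero) fun ω => ?_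
    refine sq_le_sq.2 ?_
    rw [abs_norm]
    exact (abs_real_inner_le_norm _ _).trans (mul_le_of_le_one_left (norm_nonneg _) h.2)
  have hball (h : V) (hh : ‖h‖ ≤ 1) : ∀ᵐ ω ∂P, ⟪h, d ω⟫ = 0 := by
    have hzero : ∫ ω, ⟪h, d ω⟫ ^ 2 ∂P = 0 :=
      le_antisymm ((le_ciSup hbdd ⟨h, hh⟩).trans h0.le) (integral_nonneg fun ω => sq_nonneg _)
    filter_upwards [(integral_eq_zero_iff_of_nonneg (fun ω => sq_nonneg _) (hint h)).1 hzero]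
      with ω hω
    exact (pow_eq_zero_iff two_ne_zero).1 hω
  refine ae_eq_zero_of_forall_inner (𝕜 := ℝ) fun h => ?_
  have hpos : 0 < ‖h‖ + 1 := by positivity
  have hnorm : ‖(‖h‖ + 1)⁻¹ • h‖ ≤ 1 := by
    rw [norm_smul, norm_inv, Real.norm_of_nonneg hpos.le, inv_mul_le_one₀ hpos]
    linarith
  filter_upwards [hball _ hnorm] with ω hω
  rw [real_inner_smul_left] at hω
  exact (mul_eq_zero.1 hω).resolve_left (ne_of_gt (inv_pos.2 hpos))

/-- If `μstar` represents the conditional expectation of the feature map `φ`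
given `σ(X)`, then `𝓔[μstar] = 0` (so `μstar` minimises `𝓔`), and any square-integrable
measurable `μ` with `𝓔[μ] = 0` satisfies `μ(X) = μstar(X)` `P`-a.s. -/
theorem stmt_3
    {Ω 𝒳 V : Type*} [MeasurableSpace Ω] [MeasurableSpace 𝒳]
    [NormedAddCommGroup V] [InnerProductSpace ℝ V]
    [SecondCountableTopology V] [CompleteSpace V]
    (P : Measure Ω) [IsProbabilityMeasure P]
    (X : Ω → 𝒳) (hX : Measurable X)
    (φ : Ω → V) (hφm : StronglyMeasurable φ)
    (hφ2 : Integrable (fun ω => ‖φ ω‖ ^ 2) P)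
    (μstar : 𝒳 → V) (hμsm : StronglyMeasurable μstar)
    (hμs2 : Integrable (fun ω => ‖μstar (X ω)‖ ^ 2) P)
    (hrep : ∀ h : V,
      P[(fun ω => ⟪h, φ ω⟫) | MeasurableSpace.comap X inferInstance]
        =ᵐ[P] fun ω => ⟪h, μstar (X ω)⟫) :
    risk P X φ μstar = 0 ∧
    ∀ μ : 𝒳 → V, StronglyMeasurable μ →
      Integrable (fun ω => ‖μ (X ω)‖ ^ 2) P →
      risk P X φ μ = 0 →
      (fun ω => μ (X ω)) =ᵐ[P] fun ω => μstar (X ω) := by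
  refine ⟨by simp [risk_eq_iSup_integral_inner_sub_sq hrep], fun μ hμ hμ2 h0 => ?_⟩
  rw [risk_eq_iSup_integral_inner_sub_sq hrep] at h0
  have memLp_comp {ν : 𝒳 → V} (hν : StronglyMeasurable ν)
      (hν2 : Integrable (fun ω => ‖ν (X ω)‖ ^ 2) P) : MemLp (fun ω => ν (X ω)) 2 P :=
    (memLp_two_iff_integrable_sq_norm (hν.comp_measurable hX).aestronglyMeasurable).2 hν2
  have hd := (memLp_comp hμsm hμs2).sub (memLp_comp hμ hμ2)
  filter_upwards [ae_eq_zero_of_iSup_integral_inner_sq_eq_zero hd h0] with ω hω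
  exact (sub_eq_zero.1 hω).symm
end

section
/- For every measurable μ : 𝒳 → V with E[‖μ(X)‖²] < ∞ and every h ∈ V with ‖h‖ ≤ 1, one has E[(E[⟨h, φ⟩ | σ(X)] − ⟨h, μ(X)⟩)²] ≤ E[‖φ − μ(X)‖²]; consequently the risk is bounded by the surrogate risk, 𝓔[μ] ≤ 𝓔_s[μ]. -/
open MeasureTheory RealInnerProductSpace

/-- Conditional expectation does not increase the second moment. -/
theorem integral_condExp_sq_le {Ω : Type*} {m m₀ : MeasurableSpace Ω} {P : Measure Ω}
    [IsFiniteMeasure P] (hm : m ≤ m₀) {f : Ω → ℝ} (hf : MemLp f 2 P) :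
    ∫ ω, (P[f | m]) ω ^ 2 ∂P ≤ ∫ ω, f ω ^ 2 ∂P := by
  have h_nonneg : 0 ≤ᵐ[P] ProbabilityTheory.condVar m f P :=
    condExp_nonneg (Filter.Eventually.of_forall fun ω => sq_nonneg _)
  calc ∫ ω, (P[f | m]) ω ^ 2 ∂P ≤ ∫ ω, (P[f ^ 2 | m]) ω ∂P := by
        refine integral_mono_ae (hf.condExp one_le_two).integrable_sq integrable_condExp ?_
        filter_upwards [h_nonneg,
          ProbabilityTheory.condVar_ae_eq_condExp_sq_sub_sq_condExp hm hf] with ω h₀ h₁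
        rw [h₁] at h₀
        simpa using h₀
    _ = ∫ ω, f ω ^ 2 ∂P := integral_condExp hm

/-- For every square-integrable measurable `μ` and every `h` in the unit ball
of `V`, `E[(E[⟪h, φ⟫|σ(X)] − ⟪h, μ(X)⟫)²] ≤ E[‖φ − μ(X)‖²]`; consequently
`𝓔[μ] ≤ 𝓔_s[μ]`. -/
theorem stmt_4
    {Ω 𝒳 V : Type*} [MeasurableSpace Ω] [MeasurableSpace 𝒳]
    [NormedAddCommGroup V] [InnerProductSpace ℝ V]
    [SecondCountableTopology V] [CompleteSpace V]
    (P : Measure Ω) [IsProbabilityMeasure P]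
    (X : Ω → 𝒳) (hX : Measurable X)
    (φ : Ω → V) (hφm : StronglyMeasurable φ)
    (hφ2 : Integrable (fun ω => ‖φ ω‖ ^ 2) P) :
    ∀ μ : 𝒳 → V, StronglyMeasurable μ →
      Integrable (fun ω => ‖μ (X ω)‖ ^ 2) P →
      (∀ h : V, ‖h‖ ≤ 1 →
        ∫ ω, ((P[(fun ω' => ⟪h, φ ω'⟫) | MeasurableSpace.comap X inferInstance]) ω
            - ⟪h, μ (X ω)⟫) ^ 2 ∂P
          ≤ ∫ ω, ‖φ ω - μ (X ω)‖ ^ 2 ∂P) ∧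
      risk P X φ μ ≤ ∫ ω, ‖φ ω - μ (X ω)‖ ^ 2 ∂P := by
  intro μ hμm hμ2
  have hm := hX.comap_le
  have hφL : MemLp φ 2 P := (memLp_two_iff_integrable_sq_norm hφm.aestronglyMeasurable).2 hφ2
  have hμL : MemLp (fun ω => μ (X ω)) 2 P :=
    (memLp_two_iff_integrable_sq_norm (hμm.comp_measurable hX).aestronglyMeasurable).2 hμ2
  have h_bound : ∀ h : V, ‖h‖ ≤ 1 →
      ∫ ω, ((P[(fun ω' => ⟪h, φ ω'⟫) | MeasurableSpace.comap X inferInstance]) ω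
          - ⟪h, μ (X ω)⟫) ^ 2 ∂P
        ≤ ∫ ω, ‖φ ω - μ (X ω)‖ ^ 2 ∂P := by
    intro h hh
    have hφh : MemLp (fun ω => ⟪h, φ ω⟫) 2 P := hφL.const_inner h
    have hμh : MemLp (fun ω => ⟪h, μ (X ω)⟫) 2 P := hμL.const_inner h
    have hμh_meas : StronglyMeasurable[MeasurableSpace.comap X inferInstance]
        (fun ω => ⟪h, μ (X ω)⟫) :=
      (stronglyMeasurable_const.inner hμm).comp_measurable (comap_measurable X)
    have h_sub := condExp_sub (m := MeasurableSpace.comap X inferInstance)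
      (hφh.integrable one_le_two) (hμh.integrable one_le_two)
    rw [condExp_of_stronglyMeasurable hm hμh_meas (hμh.integrable one_le_two)] at h_sub
    calc _ = ∫ ω, (P[(fun ω' => ⟪h, φ ω'⟫) - (fun ω' => ⟪h, μ (X ω')⟫) |
            MeasurableSpace.comap X inferInstance]) ω ^ 2 ∂P := by
          refine integral_congr_ae ?_
          filter_upwards [h_sub] with ω hω
          rw [hω, Pi.sub_apply]
      _ ≤ ∫ ω, (⟪h, φ ω⟫ - ⟪h, μ (X ω)⟫) ^ 2 ∂P := integral_condExp_sq_le hm (hφh.sub hμh)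
      _ ≤ ∫ ω, ‖φ ω - μ (X ω)‖ ^ 2 ∂P := by
          refine integral_mono (hφh.sub hμh).integrable_sq
            (hφL.sub hμL).norm.integrable_sq fun ω => ?_
          dsimp only
          rw [← inner_sub_right]
          refine sq_le_sq.2 ((abs_real_inner_le_norm _ _).trans ?_)
          rw [abs_norm]
          exact mul_le_of_le_one_left (norm_nonneg _) hh
  have : Nonempty {h : V // ‖h‖ ≤ 1} := ⟨⟨0, by simp⟩⟩
  exact ⟨h_bound, ciSup_le fun h => h_bound h h.2⟩
end

section
/- Assume V is finite-dimensional. Then there exists μ* ∈ H with 𝓔_s[μ*] = inf_{μ ∈ H} 𝓔_s[μ] if and only if there exist B > 0 and a sequence (μ_n)_{n ∈ ℕ} in H with ‖μ_n‖_H < B for all n and 𝓔_s[μ_n] ≤ inf_{μ ∈ H} 𝓔_s[μ] + 1/n for all n ≥ 1 (i.e. the infimum of the surrogate risk over the vector-valued RKHS is attained exactly when some minimising sequence is bounded in RKHS norm). -/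
open MeasureTheory RealInnerProductSpace

open Filter Topology

/-- An antitone sequence of closed convex sets in a real Hilbert space, all of which meet a fixed
ball, has a common point. -/
theorem exists_mem_of_antitone_isClosed_convex {H : Type*} [NormedAddCommGroup H]
    [InnerProductSpace ℝ H] [CompleteSpace H] {S : ℕ → Set H} (hanti : Antitone S)
    (hclosed : ∀ n, IsClosed (S n)) (hconv : ∀ n, Convex ℝ (S n)) {B : ℝ}
    (hB : ∀ n, ∃ x ∈ S n, ‖x‖ ≤ B) : ∃ x, ∀ n, x ∈ S n := by
  have hmin : ∀ n, ∃ x ∈ S n, ∀ y ∈ S n, ‖x‖ ≤ ‖y‖ := by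
    intro n
    obtain ⟨z, hz, -⟩ := hB n
    obtain ⟨v, hv, hveq⟩ := exists_norm_eq_iInf_of_complete_convex ⟨z, hz⟩
      (hclosed n).isComplete (hconv n) (0 : H)
    refine ⟨v, hv, fun y hy => ?_⟩
    have hle : ⨅ w : S n, ‖(0 : H) - w‖ ≤ ‖(0 : H) - y‖ :=
      ciInf_le ⟨0, by rintro _ ⟨w, rfl⟩; exact norm_nonneg _⟩ (⟨y, hy⟩ : S n)
    rw [← hveq] at hle
    simpa using hle
  choose x hxS hxmin using hmin
  have hmono : Monotone fun n => ‖x n‖ ^ 2 := fun n m hnm =>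
    pow_le_pow_left₀ (norm_nonneg _) (hxmin n _ (hanti hnm (hxS m))) 2
  have hbdd : BddAbove (Set.range fun n => ‖x n‖ ^ 2) := by
    refine ⟨B ^ 2, ?_⟩
    rintro _ ⟨n, rfl⟩
    obtain ⟨z, hz, hzB⟩ := hB n
    exact pow_le_pow_left₀ (norm_nonneg _) ((hxmin n z hz).trans hzB) 2
  have hdist : ∀ n m, n ≤ m → ‖x m - x n‖ ^ 2 ≤ 2 * (‖x m‖ ^ 2 - ‖x n‖ ^ 2) := by
    intro n m hnm
    have hmid : (1 / 2 : ℝ) • (x m + x n) ∈ S n := by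
      rw [smul_add]
      exact hconv n (hanti hnm (hxS m)) (hxS n) (by norm_num) (by norm_num) (by norm_num)
    have hnorm := hxmin n _ hmid
    rw [norm_smul, Real.norm_of_nonneg (by norm_num)] at hnorm
    have hpar := parallelogram_law_with_norm ℝ (x m) (x n)
    nlinarith [norm_nonneg (x n)]
  have hcauchy : CauchySeq x := by
    rw [Metric.cauchySeq_iff']
    intro ε hε
    have hlt : (⨆ n, ‖x n‖ ^ 2) - ε ^ 2 / 2 < ⨆ n, ‖x n‖ ^ 2 := by
      linarith [pow_pos hε 2]
    obtain ⟨N, hN⟩ := exists_lt_of_lt_ciSup hlt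
    refine ⟨N, fun n hn => ?_⟩
    rw [dist_eq_norm]
    refine lt_of_pow_lt_pow_left₀ 2 hε.le ?_
    linarith [hdist N n hn, le_ciSup hbdd n]
  obtain ⟨a, ha⟩ := cauchySeq_tendsto_of_complete hcauchy
  exact ⟨a, fun n => (hclosed n).mem_of_tendsto ha
    (eventually_atTop.2 ⟨n, fun m hm => hanti hm (hxS m)⟩)⟩

/-- A convex function with closed sublevel sets on a real Hilbert space which is bounded below and
admits a norm-bounded minimising sequence attains its infimum. -/
theorem ConvexOn.exists_eq_iInf_of_bounded_minimizing {H : Type*} [NormedAddCommGroup H]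
    [InnerProductSpace ℝ H] [CompleteSpace H] {f : H → ℝ} (hconv : ConvexOn ℝ Set.univ f)
    (hclosed : ∀ c, IsClosed {x | f x ≤ c}) (hbdd : BddBelow (Set.range f)) {B : ℝ}
    (hmin : ∀ n : ℕ, ∃ x, f x ≤ (⨅ y, f y) + 1 / ((n : ℝ) + 1) ∧ ‖x‖ ≤ B) :
    ∃ x, f x = ⨅ y, f y := by
  obtain ⟨a, ha⟩ := exists_mem_of_antitone_isClosed_convex
    (S := fun n : ℕ => {x | f x ≤ (⨅ y, f y) + 1 / ((n : ℝ) + 1)})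
    (fun n m hnm x hx => (show f x ≤ _ from hx).trans
      (add_le_add_right (Nat.one_div_le_one_div hnm) _)) (fun n => hclosed _)
    (fun n => by simpa using hconv.convex_le ((⨅ y, f y) + 1 / ((n : ℝ) + 1))) hmin
  refine ⟨a, le_antisymm ?_ (ciInf_le hbdd a)⟩
  have hlim := (tendsto_one_div_add_atTop_nhds_zero_nat (𝕜 := ℝ)).const_add (⨅ y, f y)
  rw [add_zero] at hlim
  exact ge_of_tendsto' hlim ha

section SurrogateRisk

variable {Ω V H : Type*} [MeasurableSpace Ω] [NormedAddCommGroup V] [InnerProductSpace ℝ V]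
  [NormedAddCommGroup H] [InnerProductSpace ℝ H] {P : Measure Ω} {φ : Ω → V}
  {T : Ω → (H →L[ℝ] V)}

/-- The squared residual is integrable when both terms are square integrable. -/
theorem integrable_norm_sub_apply_sq (hφm : StronglyMeasurable φ)
    (hφ2 : Integrable (fun ω => ‖φ ω‖ ^ 2) P) (hTm : ∀ x : H, StronglyMeasurable fun ω => T ω x)
    (hT2 : ∀ x : H, Integrable (fun ω => ‖T ω x‖ ^ 2) P) (x : H) :
    Integrable (fun ω => ‖φ ω - T ω x‖ ^ 2) P :=
  (memLp_two_iff_integrable_sq_norm (hφm.sub (hTm x)).aestronglyMeasurable).1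
    (((memLp_two_iff_integrable_sq_norm hφm.aestronglyMeasurable).2 hφ2).sub
      ((memLp_two_iff_integrable_sq_norm (hTm x).aestronglyMeasurable).2 (hT2 x)))

/-- The least-squares risk of a random continuous linear map is convex. -/
theorem convexOn_integral_norm_sub_apply_sq
    (hint : ∀ x : H, Integrable (fun ω => ‖φ ω - T ω x‖ ^ 2) P) :
    ConvexOn ℝ Set.univ fun x : H => ∫ ω, ‖φ ω - T ω x‖ ^ 2 ∂P := by
  refine ⟨convex_univ, fun x _ y _ a b ha hb hab => ?_⟩
  simp only [smul_eq_mul]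
  rw [← integral_const_mul, ← integral_const_mul,
    ← integral_add ((hint x).const_mul a) ((hint y).const_mul b)]
  refine integral_mono (hint _) (((hint x).const_mul a).add ((hint y).const_mul b)) fun ω => ?_
  have hsplit : φ ω - T ω (a • x + b • y) = a • (φ ω - T ω x) + b • (φ ω - T ω y) := by
    rw [map_add, map_smul, map_smul, smul_sub, smul_sub, sub_add_sub_comm, ← add_smul, hab,
      one_smul]
  have hsq : ConvexOn ℝ Set.univ fun v : V => ‖v‖ ^ 2 :=
    convexOn_univ_norm.pow (fun _ _ => norm_nonneg _) 2
  simpa only [hsplit, smul_eq_mul] using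
    hsq.2 (Set.mem_univ (φ ω - T ω x)) (Set.mem_univ (φ ω - T ω y)) ha hb hab

/-- The sublevel sets of the least-squares risk of a random continuous linear map are closed. -/
theorem isClosed_integral_norm_sub_apply_sq_le
    (hint : ∀ x : H, Integrable (fun ω => ‖φ ω - T ω x‖ ^ 2) P) (c : ℝ) :
    IsClosed {x : H | ∫ ω, ‖φ ω - T ω x‖ ^ 2 ∂P ≤ c} := by
  refine IsSeqClosed.isClosed fun u x hu hux => ?_
  have hnonneg : ∀ y : H, 0 ≤ᵐ[P] fun ω => ‖φ ω - T ω y‖ ^ 2 :=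
    fun y => Eventually.of_forall fun ω => sq_nonneg _
  have hc : 0 ≤ c := (integral_nonneg fun ω => sq_nonneg _).trans (hu 0)
  have hpoint : ∀ ω, Tendsto (fun k => ENNReal.ofReal (‖φ ω - T ω (u k)‖ ^ 2)) atTop
      (𝓝 (ENNReal.ofReal (‖φ ω - T ω x‖ ^ 2))) := fun ω =>
    ENNReal.tendsto_ofReal
      ((tendsto_const_nhds.sub (((T ω).continuous.tendsto x).comp hux)).norm.pow 2)
  have hfatou : ∫⁻ ω, ENNReal.ofReal (‖φ ω - T ω x‖ ^ 2) ∂P ≤ ENNReal.ofReal c := by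
    calc ∫⁻ ω, ENNReal.ofReal (‖φ ω - T ω x‖ ^ 2) ∂P
        = ∫⁻ ω, liminf (fun k => ENNReal.ofReal (‖φ ω - T ω (u k)‖ ^ 2)) atTop ∂P :=
          lintegral_congr fun ω => (hpoint ω).liminf_eq.symm
      _ ≤ liminf (fun k => ∫⁻ ω, ENNReal.ofReal (‖φ ω - T ω (u k)‖ ^ 2) ∂P) atTop :=
          lintegral_liminf_le' fun k => (hint (u k)).aemeasurable.ennreal_ofReal
      _ ≤ liminf (fun _ : ℕ => ENNReal.ofReal c) atTop := by
          refine liminf_le_liminf (Eventually.of_forall fun k => ?_)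
          rw [← ofReal_integral_eq_lintegral_ofReal (hint _) (hnonneg _)]
          exact ENNReal.ofReal_le_ofReal (hu k)
      _ = ENNReal.ofReal c := liminf_const _
  rw [← ofReal_integral_eq_lintegral_ofReal (hint x) (hnonneg x)] at hfatou
  exact (ENNReal.ofReal_le_ofReal_iff hc).1 hfatou

end SurrogateRisk

/-- For finite-dimensional `V`, the infimum of the surrogate risk
`𝓔_s[μ] = E[‖φ − ev(X)μ‖²]` over the vector-valued RKHS `H` is attained if and only if
there is a minimising sequence which is bounded in the RKHS norm. -/
theorem stmt_10
    {Ω 𝒳 V H : Type*} [MeasurableSpace Ω] [MeasurableSpace 𝒳]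
    [NormedAddCommGroup V] [InnerProductSpace ℝ V] [FiniteDimensional ℝ V]
    [NormedAddCommGroup H] [InnerProductSpace ℝ H] [CompleteSpace H]
    (P : Measure Ω) [IsProbabilityMeasure P]
    (X : Ω → 𝒳) (hX : Measurable X)
    (φ : Ω → V) (hφm : StronglyMeasurable φ)
    (hφ2 : Integrable (fun ω => ‖φ ω‖ ^ 2) P)
    (ev : 𝒳 → (H →L[ℝ] V))
    (hevm : ∀ μ : H, StronglyMeasurable fun ω => ev (X ω) μ)
    (hev2 : ∀ μ : H, Integrable (fun ω => ‖ev (X ω) μ‖ ^ 2) P) :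
    (∃ μstar : H,
        (∫ ω, ‖φ ω - ev (X ω) μstar‖ ^ 2 ∂P)
          = ⨅ μ : H, ∫ ω, ‖φ ω - ev (X ω) μ‖ ^ 2 ∂P) ↔
      (∃ B : ℝ, 0 < B ∧ ∃ s : ℕ → H,
        (∀ n : ℕ, ‖s n‖ < B) ∧
        (∀ n : ℕ, 1 ≤ n →
          (∫ ω, ‖φ ω - ev (X ω) (s n)‖ ^ 2 ∂P)
            ≤ (⨅ μ : H, ∫ ω, ‖φ ω - ev (X ω) μ‖ ^ 2 ∂P) + 1 / (n : ℝ))) := by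
  constructor
  · rintro ⟨m, hm⟩
    refine ⟨‖m‖ + 1, by positivity, fun _ => m, fun _ => lt_add_one _, fun n _ => ?_⟩
    rw [hm]
    exact le_add_of_nonneg_right (by positivity)
  · rintro ⟨B, -, s, hsB, hs⟩
    have hint := integrable_norm_sub_apply_sq (T := fun ω => ev (X ω)) hφm hφ2 hevm hev2
    refine (convexOn_integral_norm_sub_apply_sq hint).exists_eq_iInf_of_bounded_minimizing
      (isClosed_integral_norm_sub_apply_sq_le hint) ⟨0, ?_⟩ (B := B)
      fun n => ⟨s (n + 1), by simpa using hs (n + 1) (by simp), (hsB _).le⟩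
    rintro _ ⟨x, rfl⟩
    exact integral_nonneg fun ω => sq_nonneg _
end

section
/- Suppose 𝒳 is a Polish space, V is a finite-dimensional real inner product space, H is a real Hilbert space, and Φ : 𝒳 → (V →L[ℝ] H) is a family of continuous linear feature maps such that the linear span of {Φ x v : x ∈ 𝒳, v ∈ V} is dense in H. If the associated operator-valued kernel is continuous in each argument — i.e. for all v, w ∈ V and every fixed x ∈ 𝒳 the maps x' ↦ ⟨Φ x v, Φ x' w⟩_H and x' ↦ ⟨Φ x' v, Φ x' w⟩_H are continuous — then H is separable. -/
open RealInnerProductSpace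

/-- A map into a real inner product space is continuous as soon as its kernel is continuous in the
second argument and on the diagonal. -/
theorem continuous_of_continuous_inner {X H : Type*} [TopologicalSpace X]
    [NormedAddCommGroup H] [InnerProductSpace ℝ H] {f : X → H}
    (hsep : ∀ x, Continuous fun y => ⟪f x, f y⟫) (hdiag : Continuous fun y => ⟪f y, f y⟫) :
    Continuous f := by
  refine continuous_iff_continuousAt.2 fun x => tendsto_iff_norm_sub_tendsto_zero.2 ?_
  have hnorm : ∀ y, ‖f y - f x‖ = √(⟪f y, f y⟫ - 2 * ⟪f x, f y⟫ + ⟪f x, f x⟫) := fun y => by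
    rw [← Real.sqrt_sq (norm_nonneg (f y - f x)), norm_sub_sq_real, real_inner_comm,
      real_inner_self_eq_norm_sq, real_inner_self_eq_norm_sq]
  have hlim : Continuous fun y => √(⟪f y, f y⟫ - 2 * ⟪f x, f y⟫ + ⟪f x, f x⟫) :=
    ((hdiag.sub (continuous_const.mul (hsep x))).add continuous_const).sqrt
  simpa only [← hnorm, sub_self, norm_zero] using hlim.tendsto x

/-- If `𝒳` is Polish, `V` is a finite-dimensional real inner product space,
`H` is a real Hilbert space generated (densely spanned) by feature vectors `Φ x v`, and the
associated operator-valued kernel `(x, x') ↦ ⟪Φ x v, Φ x' w⟫` is continuous in each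
argument, then `H` is separable. -/
theorem stmt_11
    {𝒳 : Type*} [TopologicalSpace 𝒳] [PolishSpace 𝒳]
    {V H : Type*} [NormedAddCommGroup V] [InnerProductSpace ℝ V] [FiniteDimensional ℝ V]
    [NormedAddCommGroup H] [InnerProductSpace ℝ H] [CompleteSpace H]
    (Φ : 𝒳 → (V →L[ℝ] H))
    (hdense : Dense
      (Submodule.span ℝ (Set.range fun p : 𝒳 × V => Φ p.1 p.2) : Set H))
    (hcont1 : ∀ (v w : V) (x : 𝒳), Continuous fun x' : 𝒳 => ⟪Φ x v, Φ x' w⟫)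
    (hcont2 : ∀ v w : V, Continuous fun x' : 𝒳 => ⟪Φ x' v, Φ x' w⟫) :
    TopologicalSpace.SeparableSpace H := by
  have hcont (v : V) : Continuous fun x => Φ x v :=
    continuous_of_continuous_inner (hcont1 v v) (hcont2 v v)
  have hsep : TopologicalSpace.IsSeparable
      (⋃ n, Set.range fun x => Φ x (TopologicalSpace.denseSeq V n)) :=
    .iUnion fun n => TopologicalSpace.isSeparable_range (hcont _)
  have hsub : (Set.range fun p : 𝒳 × V => Φ p.1 p.2) ⊆
      closure (⋃ n, Set.range fun x => Φ x (TopologicalSpace.denseSeq V n)) := by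
    rintro _ ⟨⟨x, v⟩, rfl⟩
    refine map_mem_closure (Φ x).continuous (TopologicalSpace.denseRange_denseSeq V v) ?_
    rintro _ ⟨n, rfl⟩
    exact Set.mem_iUnion.2 ⟨n, x, rfl⟩
  have huniv := ((hsep.closure.mono hsub).span (R := ℝ)).closure
  rw [hdense.closure_eq] at huniv
  exact TopologicalSpace.isSeparable_univ_iff.1 huniv
end

section
/- Let 𝒴 be a measurable space, ε > 0, and g : 𝒴 → ℝ a bounded measurable function with g(y) ≥ ε for all y ∈ 𝒴. Then for every Markov kernel κ from the interval [-1, 1] to 𝒴 (a measurable family x ↦ κ(x) of probability measures on 𝒴) there exists no c ∈ ℝ such that ∫ g dκ(x) = c·x for every x ∈ [-1, 1]. (Hence, for the scalar kernel K(x, x') = x·x' on 𝒳 = [-1, 1], whose RKHS H_K consists exactly of the linear functions x ↦ c·x, no conditional distribution of Y given X = x can satisfy E[h(Y)|X = x] = f_h(x) with f_h ∈ H_K for all x whenever the output RKHS contains a function bounded below by ε > 0.) -/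
open MeasureTheory ProbabilityTheory

/-- Let `g : 𝒴 → ℝ` be bounded, measurable and bounded below by `ε > 0`.
For any Markov kernel `κ` from `[-1, 1]` to `𝒴`, there is no `c ∈ ℝ` with
`∫ g dκ(x) = c·x` for all `x ∈ [-1, 1]`; i.e. the conditional expectation of `g` cannot be
an element of the RKHS of the kernel `K(x, x') = x·x'` on `[-1, 1]`. -/
theorem stmt_12
    {𝒴 : Type*} [MeasurableSpace 𝒴]
    (ε : ℝ) (hε : 0 < ε)
    (g : 𝒴 → ℝ) (hgm : Measurable g)
    (hgb : ∃ C : ℝ, ∀ y : 𝒴, |g y| ≤ C)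
    (hg : ∀ y : 𝒴, ε ≤ g y)
    (κ : Kernel (Set.Icc (-1 : ℝ) 1) 𝒴) [IsMarkovKernel κ] :
    ¬ ∃ c : ℝ, ∀ x : Set.Icc (-1 : ℝ) 1, (∫ y, g y ∂(κ x)) = c * (x : ℝ) := by
  rintro ⟨c, hc⟩
  obtain ⟨C, hC⟩ := hgb
  have h0 := hc ⟨0, by norm_num, by norm_num⟩
  set μ := κ ⟨0, by norm_num, by norm_num⟩
  have hint : Integrable g μ :=
    .of_bound hgm.aestronglyMeasurable C (.of_forall hC)
  have hle : ∫ _, ε ∂μ ≤ ∫ y, g y ∂μ :=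
    integral_mono (integrable_const ε) hint hg
  rw [h0] at hle
  simp at hle
  linarith
end

section
/- Let μ, μ* ∈ H, and suppose ω ↦ ‖ev(X ω) ∘ (ev(X ω))†‖ (operator norm of the kernel Γ(X, X) = ev(X) ∘ ev(X)†) is integrable with c := E[‖ev(X) ∘ (ev(X))†‖]. Then for every h ∈ V with ‖h‖ ≤ 1, E[⟨h, ev(X)μ* − ev(X)μ⟩²] ≤ c · ‖μ* − μ‖_H²; consequently, if μ* represents the conditional expectation (for every h ∈ V, E[⟨h, φ⟩ | σ(X)] = ⟨h, ev(X)μ*⟩ P-a.s.), then 𝓔[μ] ≤ c · ‖μ* − μ‖_H². -/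
open MeasureTheory RealInnerProductSpace

/-- The risk `𝓔[μ] = sup_{h ∈ V, ‖h‖ ≤ 1} E[(E[⟪h, φ⟫ | σ(X)] − ⟪h, ev(X)μ⟫)²]`
of an element `μ` of a vector-valued RKHS `H` with evaluation operators `ev`. -/
noncomputable def riskH
    {Ω 𝒳 V H : Type*} [MeasurableSpace Ω] [MeasurableSpace 𝒳]
    [NormedAddCommGroup V] [InnerProductSpace ℝ V]
    [NormedAddCommGroup H] [InnerProductSpace ℝ H]
    (P : Measure Ω) (X : Ω → 𝒳) (φ : Ω → V) (ev : 𝒳 → (H →L[ℝ] V)) (μ : H) : ℝ :=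
  ⨆ h : {h : V // ‖h‖ ≤ 1},
    ∫ ω, ((P[(fun ω' => ⟪(h : V), φ ω'⟫) | MeasurableSpace.comap X inferInstance]) ω
      - ⟪(h : V), ev (X ω) μ⟫) ^ 2 ∂P

/-- Squared Cauchy–Schwarz for an evaluation operator: for `‖h‖ ≤ 1`,
`⟪h, A f⟫²` is controlled by the operator norm of `A ∘ A†`. -/
theorem inner_apply_sq_le_norm_comp_adjoint_mul
    {V H : Type*} [NormedAddCommGroup V] [InnerProductSpace ℝ V] [CompleteSpace V]
    [NormedAddCommGroup H] [InnerProductSpace ℝ H] [CompleteSpace H]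
    (A : H →L[ℝ] V) (f : H) {h : V} (hh : ‖h‖ ≤ 1) :
    ⟪h, A f⟫ ^ 2 ≤ ‖A.comp (ContinuousLinearMap.adjoint A)‖ * ‖f‖ ^ 2 := by
  have hnorm : ‖A.comp (ContinuousLinearMap.adjoint A)‖ = ‖A‖ * ‖A‖ := by
    simpa using ContinuousLinearMap.norm_adjoint_comp_self (ContinuousLinearMap.adjoint A)
  have habs : |⟪h, A f⟫| ≤ ‖A‖ * ‖f‖ :=
    calc |⟪h, A f⟫| ≤ ‖h‖ * ‖A f‖ := abs_real_inner_le_norm h (A f)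
      _ ≤ 1 * ‖A f‖ := by gcongr
      _ = ‖A f‖ := one_mul _
      _ ≤ ‖A‖ * ‖f‖ := A.le_opNorm f
  calc ⟪h, A f⟫ ^ 2 = |⟪h, A f⟫| ^ 2 := (sq_abs _).symm
    _ ≤ (‖A‖ * ‖f‖) ^ 2 := by gcongr
    _ = ‖A.comp (ContinuousLinearMap.adjoint A)‖ * ‖f‖ ^ 2 := by rw [hnorm]; ring

/-- With `c = E[‖ev(X) ∘ ev(X)†‖]` (the mean operator norm of the kernel
`Γ(X, X)`), for all `μ, μstar ∈ H` and unit `h ∈ V`,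
`E[⟪h, ev(X)μstar − ev(X)μ⟫²] ≤ c ‖μstar − μ‖²`; hence if `μstar` represents the
conditional expectation then `𝓔[μ] ≤ c ‖μstar − μ‖²`. -/
theorem stmt_14
    {Ω 𝒳 V H : Type*} [MeasurableSpace Ω] [MeasurableSpace 𝒳]
    [NormedAddCommGroup V] [InnerProductSpace ℝ V]
    [SecondCountableTopology V] [CompleteSpace V]
    [NormedAddCommGroup H] [InnerProductSpace ℝ H] [CompleteSpace H]
    (P : Measure Ω) [IsProbabilityMeasure P]
    (X : Ω → 𝒳) (hX : Measurable X)
    (φ : Ω → V) (hφm : StronglyMeasurable φ)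
    (hφ2 : Integrable (fun ω => ‖φ ω‖ ^ 2) P)
    (ev : 𝒳 → (H →L[ℝ] V))
    (hevm : ∀ μ : H, StronglyMeasurable fun ω => ev (X ω) μ)
    (hev2 : ∀ μ : H, Integrable (fun ω => ‖ev (X ω) μ‖ ^ 2) P)
    (μ μstar : H) (c : ℝ)
    (hint : Integrable
      (fun ω => ‖(ev (X ω)).comp (ContinuousLinearMap.adjoint (ev (X ω)))‖) P)
    (hc : c = ∫ ω, ‖(ev (X ω)).comp (ContinuousLinearMap.adjoint (ev (X ω)))‖ ∂P) :
    (∀ h : V, ‖h‖ ≤ 1 →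
      (∫ ω, ⟪h, ev (X ω) μstar - ev (X ω) μ⟫ ^ 2 ∂P) ≤ c * ‖μstar - μ‖ ^ 2) ∧
    ((∀ h : V,
        P[(fun ω => ⟪h, φ ω⟫) | MeasurableSpace.comap X inferInstance]
          =ᵐ[P] fun ω => ⟪h, ev (X ω) μstar⟫) →
      riskH P X φ ev μ ≤ c * ‖μstar - μ‖ ^ 2) := by
  have hbound : ∀ h : V, ‖h‖ ≤ 1 →
      (∫ ω, ⟪h, ev (X ω) μstar - ev (X ω) μ⟫ ^ 2 ∂P) ≤ c * ‖μstar - μ‖ ^ 2 := by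
    intro h hh
    rw [hc, ← integral_mul_const]
    refine integral_mono_of_nonneg (.of_forall fun ω => sq_nonneg _) (hint.mul_const _)
      (.of_forall fun ω => ?_)
    simpa only [map_sub] using
      inner_apply_sq_le_norm_comp_adjoint_mul (ev (X ω)) (μstar - μ) hh
  refine ⟨hbound, fun hrep => ?_⟩
  have : Nonempty {h : V // ‖h‖ ≤ 1} := ⟨⟨0, by simp⟩⟩
  refine ciSup_le fun h => ?_
  refine (integral_congr_ae ?_).trans_le (hbound h h.2)
  filter_upwards [hrep h] with ω hω
  rw [hω, inner_sub_right]
end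

section
/- Let H and V be real Hilbert spaces, n ∈ ℕ, A : Fin n → (H →L[ℝ] V) a finite family of continuous linear operators, v : Fin n → V, and λ > 0. Then the regularized empirical risk J(f) := ∑_{i} ‖v i − A i f‖²_V + λ‖f‖²_H has a unique minimiser f* over H, and there exist coefficients c : Fin n → V, unique, such that f* = ∑_i (A i)† (c i) and, for every j, ∑_i A j ((A i)† (c i)) + λ · (c j) = v j. -/
open RealInnerProductSpace

section RegularizedLeastSquares

open ContinuousLinearMap

variable {ι H V : Type*} [Fintype ι]
  [NormedAddCommGroup H] [InnerProductSpace ℝ H] [CompleteSpace H]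
  [NormedAddCommGroup V] [InnerProductSpace ℝ V] [CompleteSpace V]

/-- The normal equation of regularized least squares is solvable, by Lax–Milgram. -/
theorem exists_smul_eq_sum_adjoint_sub (A : ι → (H →L[ℝ] V)) (v : ι → V)
    {lam : ℝ} (hlam : 0 < lam) :
    ∃ f : H, lam • f = ∑ i, adjoint (A i) (v i - A i f) := by
  let T : H →L[ℝ] H := ∑ i, (adjoint (A i)).comp (A i) + lam • ContinuousLinearMap.id ℝ H
  have hT (f : H) : T f = ∑ i, adjoint (A i) (A i f) + lam • f := by
    simp [T]
  let B : H →L[ℝ] H →L[ℝ] ℝ := (innerSL ℝ).comp T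
  have hB : IsCoercive B := by
    refine ⟨lam, hlam, fun f => ?_⟩
    have hBf : B f f = ∑ i, ‖A i f‖ ^ 2 + lam * ‖f‖ ^ 2 := by
      simp [B, hT, adjoint_inner_left]
    have := Finset.sum_nonneg fun i (_ : i ∈ Finset.univ) => sq_nonneg ‖A i f‖
    rw [hBf]
    linarith
  obtain ⟨f, hf⟩ := hB.continuousLinearEquivOfBilin.surjective (∑ i, adjoint (A i) (v i))
  have hTf : T f = ∑ i, adjoint (A i) (v i) := by
    rw [← hf]
    exact hB.unique_continuousLinearEquivOfBilin fun _ => rfl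
  refine ⟨f, ?_⟩
  simp only [map_sub, Finset.sum_sub_distrib, ← hTf, hT]
  abel

/-- At a solution `f₀` of the normal equation, the regularized risk exceeds its value at `f₀`
by a quadratic form in the displacement. -/
theorem regularized_risk_eq_add (A : ι → (H →L[ℝ] V)) (v : ι → V) {lam : ℝ} {f₀ : H}
    (h : lam • f₀ = ∑ i, adjoint (A i) (v i - A i f₀)) (f : H) :
    (∑ i, ‖v i - A i f‖ ^ 2) + lam * ‖f‖ ^ 2 =
      (∑ i, ‖v i - A i f₀‖ ^ 2) + lam * ‖f₀‖ ^ 2 +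
        ((∑ i, ‖A i (f - f₀)‖ ^ 2) + lam * ‖f - f₀‖ ^ 2) := by
  have hinner : lam * ⟪f₀, f - f₀⟫ = ∑ i, ⟪v i - A i f₀, A i (f - f₀)⟫ := by
    rw [← real_inner_smul_left, h, sum_inner]
    simp only [adjoint_inner_left]
  have hres (i : ι) : ‖v i - A i f‖ ^ 2 =
      ‖v i - A i f₀‖ ^ 2 - 2 * ⟪v i - A i f₀, A i (f - f₀)⟫ + ‖A i (f - f₀)‖ ^ 2 := by
    rw [← norm_sub_sq_real, map_sub]
    congr 2
    abel
  have hnorm : ‖f‖ ^ 2 = ‖f₀‖ ^ 2 + 2 * ⟪f₀, f - f₀⟫ + ‖f - f₀‖ ^ 2 := by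
    rw [← norm_add_sq_real, add_sub_cancel]
  simp only [hres, hnorm, Finset.sum_add_distrib, Finset.sum_sub_distrib, ← Finset.mul_sum,
    ← hinner]
  ring

theorem regularized_risk_add_le (A : ι → (H →L[ℝ] V)) (v : ι → V) {lam : ℝ} {f₀ : H}
    (h : lam • f₀ = ∑ i, adjoint (A i) (v i - A i f₀)) (f : H) :
    (∑ i, ‖v i - A i f₀‖ ^ 2) + lam * ‖f₀‖ ^ 2 + lam * ‖f - f₀‖ ^ 2 ≤
      (∑ i, ‖v i - A i f‖ ^ 2) + lam * ‖f‖ ^ 2 := by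
  have := Finset.sum_nonneg fun i (_ : i ∈ Finset.univ) => sq_nonneg ‖A i (f - f₀)‖
  rw [regularized_risk_eq_add A v h f]
  linarith

end RegularizedLeastSquares

/-- Representer theorem for vector-valued regularized least squares. The
regularized empirical risk `J(f) = ∑ i, ‖v i − A i f‖² + λ‖f‖²` has a unique minimiser
`f*` over `H`, and there are unique coefficients `c i ∈ V` with `f* = ∑ i, (A i)† (c i)`
solving the linear system `∑ i, A j ((A i)† (c i)) + λ • c j = v j` for all `j`. -/
theorem stmt_15
    {H V : Type*}
    [NormedAddCommGroup H] [InnerProductSpace ℝ H] [CompleteSpace H]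
    [NormedAddCommGroup V] [InnerProductSpace ℝ V] [CompleteSpace V]
    (n : ℕ) (A : Fin n → (H →L[ℝ] V)) (v : Fin n → V)
    (lam : ℝ) (hlam : 0 < lam) :
    ∃ (fstar : H) (c : Fin n → V),
      (∀ f : H,
        (∑ i, ‖v i - A i fstar‖ ^ 2) + lam * ‖fstar‖ ^ 2
          ≤ (∑ i, ‖v i - A i f‖ ^ 2) + lam * ‖f‖ ^ 2) ∧
      (∀ g : H,
        (∀ f : H,
          (∑ i, ‖v i - A i g‖ ^ 2) + lam * ‖g‖ ^ 2
            ≤ (∑ i, ‖v i - A i f‖ ^ 2) + lam * ‖f‖ ^ 2) → g = fstar) ∧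
      fstar = ∑ i, ContinuousLinearMap.adjoint (A i) (c i) ∧
      (∀ j : Fin n,
        (∑ i, A j (ContinuousLinearMap.adjoint (A i) (c i))) + lam • c j = v j) ∧
      (∀ c' : Fin n → V,
        (∀ j : Fin n,
          (∑ i, A j (ContinuousLinearMap.adjoint (A i) (c' i))) + lam • c' j = v j) →
        c' = c) := by
  obtain ⟨f₀, h₀⟩ := exists_smul_eq_sum_adjoint_sub A v hlam
  have hmin {f₁ : H}
      (h₁ : lam • f₁ = ∑ i, ContinuousLinearMap.adjoint (A i) (v i - A i f₁)) (f : H) :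
      (∑ i, ‖v i - A i f₁‖ ^ 2) + lam * ‖f₁‖ ^ 2
        ≤ (∑ i, ‖v i - A i f‖ ^ 2) + lam * ‖f‖ ^ 2 := by
    have := regularized_risk_add_le A v h₁ f
    have : 0 ≤ lam * ‖f - f₁‖ ^ 2 := by positivity
    linarith
  have huniq (g : H)
      (hg : ∀ f : H, (∑ i, ‖v i - A i g‖ ^ 2) + lam * ‖g‖ ^ 2
        ≤ (∑ i, ‖v i - A i f‖ ^ 2) + lam * ‖f‖ ^ 2) : g = f₀ := by
    have hle : lam * ‖g - f₀‖ ^ 2 ≤ 0 := by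
      linarith [regularized_risk_add_le A v h₀ g, hg f₀]
    have hsq : ‖g - f₀‖ ^ 2 = 0 :=
      le_antisymm (nonpos_of_mul_nonpos_right hle hlam) (sq_nonneg _)
    exact sub_eq_zero.mp (norm_eq_zero.mp (pow_eq_zero_iff two_ne_zero |>.mp hsq))
  have hf₀ : f₀ = ∑ i, ContinuousLinearMap.adjoint (A i) (lam⁻¹ • (v i - A i f₀)) := by
    simp only [map_smul, ← Finset.smul_sum, ← h₀, inv_smul_smul₀ hlam.ne']
  refine ⟨f₀, fun i => lam⁻¹ • (v i - A i f₀), hmin h₀, huniq, hf₀, fun j => ?_,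
    fun c hc => ?_⟩
  · rw [← map_sum, ← hf₀, smul_inv_smul₀ hlam.ne', add_sub_cancel]
  · have hres (j : Fin n) :
        lam • c j = v j - A j (∑ i, ContinuousLinearMap.adjoint (A i) (c i)) := by
      rw [← hc j, map_sum, add_sub_cancel_left]
    have hsum : ∑ i, ContinuousLinearMap.adjoint (A i) (c i) = f₀ := by
      refine huniq _ (hmin ?_)
      simp only [← hres, map_smul, Finset.smul_sum]
    ext j
    rw [← hsum, ← hres, inv_smul_smul₀ hlam.ne']
end
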